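/- Let Ω ⊆ ℝⁿ, n ≥ 2, be open and bounded, and let (X, ‖·‖_X) be a rearrangement invariant space over Ω. If W^{2,1}_{Δ,0}(Ω) ⊆ X, then Λ_n^0(Ω) ⊆ X, where Λ_2^0(Ω) = L_{exp,0}(Ω) when n = 2 and Λ_n^0(Ω) = L_0^{n/(n−2),∞}(Ω) when n ≥ 3. In other words, Λ_n^0(Ω) is the smallest rearrangement invariant space over Ω containing W^{2,1}_{Δ,0}(Ω). -/

import Mathlib

open MeasureTheory Filter Topology
open scoped ENNReal

noncomputable section

/-- Euclidean space ℝⁿ. -/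
abbrev Euc (n : ℕ) := EuclideanSpace ℝ (Fin n)

/-- The (pointwise) Laplacian of a function on ℝⁿ: the trace of the second derivative. -/
def lapl (n : ℕ) (φ : Euc n → ℝ) (x : Euc n) : ℝ :=
  ∑ i : Fin n,
    iteratedFDeriv ℝ 2 φ x ![EuclideanSpace.single i (1 : ℝ), EuclideanSpace.single i (1 : ℝ)]

/-- A test function on Ω: smooth and compactly supported inside Ω. -/
def IsTestFun (n : ℕ) (Ω : Set (Euc n)) (φ : Euc n → ℝ) : Prop :=
  ContDiff ℝ (⊤ : ℕ∞) φ ∧ HasCompactSupport φ ∧ tsupport φ ⊆ Ω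

/-- `u ∈ W₀^{1,1}(Ω)`: `u` is an L¹(Ω) limit of test functions whose gradients converge
in L¹(Ω) (i.e. `u` is in the closure of C_c^∞(Ω) in the W^{1,1} norm). -/
def MemW0_1_1 (n : ℕ) (Ω : Set (Euc n)) (u : Euc n → ℝ) : Prop :=
  IntegrableOn u Ω volume ∧
  ∃ φ : ℕ → Euc n → ℝ, (∀ k, IsTestFun n Ω (φ k)) ∧
    Tendsto (fun k => ∫ x in Ω, |φ k x - u x|) atTop (𝓝 0) ∧
    ∃ g : Euc n → Euc n →L[ℝ] ℝ,
      IntegrableOn (fun x => ‖g x‖) Ω volume ∧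
      Tendsto (fun k => ∫ x in Ω, ‖fderiv ℝ (φ k) x - g x‖) atTop (𝓝 0)

/-- `u ∈ W^{2,1}_Δ(Ω)` with distributional Laplacian `f ∈ L¹(Ω)`. -/
def MemW21Delta (n : ℕ) (Ω : Set (Euc n)) (u f : Euc n → ℝ) : Prop :=
  MemW0_1_1 n Ω u ∧ IntegrableOn f Ω volume ∧
    ∀ ψ : Euc n → ℝ, IsTestFun n Ω ψ →
      ∫ x in Ω, u x * lapl n ψ x = ∫ x in Ω, f x * ψ x

/-- `u ∈ W^{2,1}_{Δ,0}(Ω)` with Laplacian `f`: `u` is an L¹(Ω) limit of test functions `φ k`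
with `Δ(φ k) → f` in L¹(Ω) (closure of C_c^∞(Ω) in the norm ‖Δu‖₁). -/
def MemW21Delta0 (n : ℕ) (Ω : Set (Euc n)) (u f : Euc n → ℝ) : Prop :=
  IntegrableOn u Ω volume ∧ IntegrableOn f Ω volume ∧
  ∃ φ : ℕ → Euc n → ℝ, (∀ k, IsTestFun n Ω (φ k)) ∧
    Tendsto (fun k => ∫ x in Ω, |φ k x - u x|) atTop (𝓝 0) ∧
    Tendsto (fun k => ∫ x in Ω, |lapl n (φ k) x - f x|) atTop (𝓝 0)

/-- The decreasing rearrangement `u*(t)` of `u` on Ω. -/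
def decRearr (n : ℕ) (Ω : Set (Euc n)) (u : Euc n → ℝ) (t : ℝ) : ℝ :=
  sInf {s : ℝ | 0 ≤ s ∧ volume {x ∈ Ω | s < |u x|} ≤ ENNReal.ofReal t}

/-- `‖f‖_{L¹(Ω)}`. -/
def L1norm (n : ℕ) (Ω : Set (Euc n)) (f : Euc n → ℝ) : ℝ := ∫ x in Ω, |f x|

/-- ω_{n-1}: surface measure of the unit sphere in ℝⁿ. -/
def omegaS (n : ℕ) : ℝ := 2 * Real.pi ^ ((n : ℝ) / 2) / Real.Gamma ((n : ℝ) / 2)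

/-- c_n = 1/((n-2) ω_{n-1}). -/
def cConst (n : ℕ) : ℝ := 1 / (((n : ℝ) - 2) * omegaS n)

/-- `N*_V(t)`: the rearrangement of the Green function of the ball of volume V. -/
def NstarV (n : ℕ) (V t : ℝ) : ℝ :=
  if n = 2 then (1 / (4 * Real.pi)) * Real.log (V / t)
  else cConst n * (omegaS n / (n : ℝ)) ^ (((n : ℝ) - 2) / (n : ℝ)) *
    (t ^ (-(((n : ℝ) - 2) / (n : ℝ))) - V ^ (-(((n : ℝ) - 2) / (n : ℝ))))

/-- `N*_∞(t)` (for n ≥ 3). -/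
def NstarInf (n : ℕ) (t : ℝ) : ℝ :=
  cConst n * (omegaS n / (n : ℝ)) ^ (((n : ℝ) - 2) / (n : ℝ)) *
    t ^ (-(((n : ℝ) - 2) / (n : ℝ)))

/-- The maximal function `u**(t) = (1/t) ∫₀ᵗ u*(s) ds`. -/
def maximalFn (n : ℕ) (Ω : Set (Euc n)) (u : Euc n → ℝ) (t : ℝ) : ℝ :=
  (1 / t) * ∫ s in (0:ℝ)..t, decRearr n Ω u s

/-- `u ∈ L_exp(Ω)`. -/
def MemLexp (n : ℕ) (Ω : Set (Euc n)) (u : Euc n → ℝ) : Prop :=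
  ∃ M : ℝ, ∀ t : ℝ, 0 < t → t ≤ (volume Ω).toReal →
    decRearr n Ω u t / (1 + Real.log ((volume Ω).toReal / t)) ≤ M

/-- `u ∈ L_{exp,0}(Ω)`. -/
def MemLexp0 (n : ℕ) (Ω : Set (Euc n)) (u : Euc n → ℝ) : Prop :=
  MemLexp n Ω u ∧
    Tendsto (fun t : ℝ => maximalFn n Ω u t / Real.log (1 / t)) (𝓝[>] 0) (𝓝 0)

/-- `u ∈ L^{n/(n-2),∞}(Ω)`. -/
def MemWeakL (n : ℕ) (Ω : Set (Euc n)) (u : Euc n → ℝ) : Prop :=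
  ∃ M : ℝ, ∀ t : ℝ, 0 < t → t ≤ (volume Ω).toReal →
    t ^ (((n : ℝ) - 2) / (n : ℝ)) * decRearr n Ω u t ≤ M

/-- `u ∈ L₀^{n/(n-2),∞}(Ω)`. -/
def MemWeakL0 (n : ℕ) (Ω : Set (Euc n)) (u : Euc n → ℝ) : Prop :=
  MemWeakL n Ω u ∧
    Tendsto (fun t : ℝ => t ^ (((n : ℝ) - 2) / (n : ℝ)) * maximalFn n Ω u t) (𝓝[>] 0) (𝓝 0)

/-- `Λ_n^0(Ω)`: equals `L_{exp,0}(Ω)` if n = 2 and `L₀^{n/(n-2),∞}(Ω)` if n ≥ 3. -/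
def MemLambda0 (n : ℕ) (Ω : Set (Euc n)) (u : Euc n → ℝ) : Prop :=
  if n = 2 then MemLexp0 n Ω u else MemWeakL0 n Ω u

/-- A rearrangement invariant (r.i.) space over Ω ⊆ ℝⁿ: a Banach space of (classes of)
a.e.-finite measurable functions on Ω which is an ideal Banach lattice (property (i))
and rearrangement invariant (property (ii)). -/
structure RISpace (n : ℕ) (Omg : Set (Euc n)) where
  carrier : Set (Euc n → ℝ)
  Xnorm : (Euc n → ℝ) → ℝ
  mem_aemeasurable : ∀ f ∈ carrier, AEMeasurable f (volume.restrict Omg)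
  zero_mem : (0 : Euc n → ℝ) ∈ carrier
  add_mem : ∀ f g : Euc n → ℝ, f ∈ carrier → g ∈ carrier → f + g ∈ carrier
  smul_mem : ∀ (c : ℝ) (f : Euc n → ℝ), f ∈ carrier → c • f ∈ carrier
  norm_nonneg : ∀ f ∈ carrier, 0 ≤ Xnorm f
  norm_eq_zero_iff : ∀ f ∈ carrier,
    (Xnorm f = 0 ↔ ∀ᵐ x ∂(volume.restrict Omg), f x = 0)
  norm_add_le : ∀ f g : Euc n → ℝ, f ∈ carrier → g ∈ carrier →
    Xnorm (f + g) ≤ Xnorm f + Xnorm g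
  norm_smul : ∀ (c : ℝ) (f : Euc n → ℝ), f ∈ carrier → Xnorm (c • f) = |c| * Xnorm f
  /-- Property (i): the ideal lattice property. -/
  ideal : ∀ f g : Euc n → ℝ, f ∈ carrier → AEMeasurable g (volume.restrict Omg) →
    (∀ᵐ x ∂(volume.restrict Omg), |g x| ≤ |f x|) → g ∈ carrier ∧ Xnorm g ≤ Xnorm f
  /-- Property (ii): rearrangement invariance. -/
  rearr_invariant : ∀ f g : Euc n → ℝ, f ∈ carrier →
    AEMeasurable g (volume.restrict Omg) →
    (∀ s : ℝ, 0 ≤ s → volume {x ∈ Omg | s < |f x|} = volume {x ∈ Omg | s < |g x|}) →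
    g ∈ carrier ∧ Xnorm g = Xnorm f
  /-- Completeness: X is a Banach space. -/
  complete : ∀ F : ℕ → Euc n → ℝ, (∀ k, F k ∈ carrier) →
    (∀ ε : ℝ, 0 < ε → ∃ N : ℕ, ∀ j k : ℕ, N ≤ j → N ≤ k → Xnorm (F j - F k) < ε) →
    ∃ g ∈ carrier, Tendsto (fun k => Xnorm (F k - g)) atTop (𝓝 0)

section

theorem ae_summable_norm_of_summable_integral_norm {α : Type*} [MeasurableSpace α] {μ : Measure α}
    {F : ℕ → α → ℝ} (hF : ∀ i, Integrable (F i) μ) (hs : Summable fun i => ∫ a, |F i a| ∂μ) :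
    (∀ᵐ a ∂μ, Summable fun i => |F i a|) ∧ Integrable (fun a => ∑' i, |F i a|) μ := by
  have hfin : ∑' i, ∫⁻ a, ‖F i a‖ₑ ∂μ ≠ ∞ := by
    have h1 : ∀ i, ∫⁻ a, ‖F i a‖ₑ ∂μ = ENNReal.ofReal (∫ a, |F i a| ∂μ) := fun i => by
      rw [← ofReal_integral_norm_eq_lintegral_enorm (hF i)]; rfl
    simp_rw [h1]
    exact hs.tsum_ofReal_ne_top
  have hae : ∀ᵐ a ∂μ, ∑' i, ‖F i a‖ₑ < ∞ := by
    refine ae_lt_top' (AEMeasurable.tsum fun i => (hF i).1.enorm) ?_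
    rwa [lintegral_tsum fun i => (hF i).1.enorm]
  have hae' : ∀ᵐ a ∂μ, Summable fun i => |F i a| := by
    filter_upwards [hae] with a ha
    have := (ENNReal.tsum_coe_ne_top_iff_summable (f := fun i => ‖F i a‖₊)).1 ha.ne
    exact NNReal.summable_coe.2 this
  refine ⟨hae', ?_⟩
  refine ⟨aestronglyMeasurable_of_tendsto_ae (f := fun k a => ∑ i ∈ Finset.range k, |F i a|) atTop
    (fun k => Finset.aestronglyMeasurable_fun_sum _ fun i _ => (hF i).1.norm) ?_, ?_⟩
  · filter_upwards [hae'] with a ha using ha.hasSum.tendsto_sum_nat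
  · refine lt_of_le_of_lt (lintegral_mono fun a => ?_) ((lintegral_tsum (μ := μ)
      fun i => (hF i).1.enorm).trans_lt hfin.lt_top)
    by_cases ha : Summable fun i => |F i a|
    · rw [Real.enorm_of_nonneg (tsum_nonneg fun i => abs_nonneg _),
        ENNReal.ofReal_tsum_of_nonneg (fun i => abs_nonneg _) ha]
      simp [Real.enorm_eq_ofReal_abs]
    · simp [tsum_eq_zero_of_not_summable ha]

theorem tendsto_integral_abs_sum_sub_tsum {α : Type*} [MeasurableSpace α] {μ : Measure α}
    {F : ℕ → α → ℝ} (hF : ∀ i, Integrable (F i) μ) (hs : Summable fun i => ∫ a, |F i a| ∂μ) :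
    Integrable (fun a => ∑' i, F i a) μ ∧
    Tendsto (fun k => ∫ a, |∑ i ∈ Finset.range k, F i a - ∑' i, F i a| ∂μ) atTop (𝓝 0) := by
  obtain ⟨hae, hint⟩ := ae_summable_norm_of_summable_integral_norm hF hs
  have hmeas : AEStronglyMeasurable (fun a => ∑' i, F i a) μ := by
    refine aestronglyMeasurable_of_tendsto_ae (f := fun k a => ∑ i ∈ Finset.range k, F i a) atTop
      (fun k => Finset.aestronglyMeasurable_fun_sum _ fun i _ => (hF i).1) ?_
    filter_upwards [hae] with a ha using ha.of_abs.hasSum.tendsto_sum_nat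
  have hle : ∀ᵐ a ∂μ, |∑' i, F i a| ≤ ∑' i, |F i a| := by
    filter_upwards [hae] with a ha using norm_tsum_le_tsum_norm (f := fun i => F i a) ha
  refine ⟨hint.mono' hmeas hle, ?_⟩
  have key := tendsto_integral_of_dominated_convergence (μ := μ)
    (F := fun k a => |∑ i ∈ Finset.range k, F i a - ∑' i, F i a|) (f := fun _ => (0 : ℝ))
    (fun a => 2 * ∑' i, |F i a|) (fun k => ((Finset.aestronglyMeasurable_fun_sum _
      fun i _ => (hF i).1).sub hmeas).norm) (hint.const_mul 2) ?_ ?_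
  · simpa using key
  · intro k
    filter_upwards [hae, hle] with a ha h
    rw [Real.norm_eq_abs, abs_abs]
    have h2 : |∑ i ∈ Finset.range k, F i a| ≤ ∑' i, |F i a| :=
      (Finset.abs_sum_le_sum_abs _ _).trans (ha.sum_le_tsum _ fun _ _ => abs_nonneg _)
    have h3 := abs_sub (∑ i ∈ Finset.range k, F i a) (∑' i, F i a)
    linarith
  · filter_upwards [hae] with a ha
    have := (ha.of_abs.hasSum.tendsto_sum_nat.sub_const (∑' i, F i a)).abs
    simpa using this

variable {n : ℕ} {Ω : Set (Euc n)}

theorem two_le_top : (2 : WithTop ℕ∞) ≤ ((⊤ : ℕ∞) : WithTop ℕ∞) :=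
  WithTop.coe_le_coe.2 (le_top : (2 : ℕ∞) ≤ ⊤)

theorem lapl_sum {w : ℕ → Euc n → ℝ} (hw : ∀ j, IsTestFun n Ω (w j)) (s : Finset ℕ) (x : Euc n) :
    lapl n (fun y => ∑ j ∈ s, w j y) x = ∑ j ∈ s, lapl n (w j) x := by
  unfold lapl
  rw [Finset.sum_comm]
  refine Finset.sum_congr rfl fun i _ => ?_
  rw [iteratedFDeriv_fun_sum_apply fun j _ => ((hw j).1.of_le two_le_top).contDiffAt]
  simp

theorem lapl_const_mul (c : ℝ) {φ : Euc n → ℝ} (hφ : IsTestFun n Ω φ) (x : Euc n) :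
    lapl n (fun y => c * φ y) x = c * lapl n φ x := by
  unfold lapl
  rw [Finset.mul_sum]
  refine Finset.sum_congr rfl fun i _ => ?_
  have h := iteratedFDeriv_const_smul_apply (i := 2) (a := c) (x := x)
    (hφ.1.of_le (m := 2) two_le_top).contDiffAt
  have h' : (fun y => c * φ y) = c • φ := rfl
  rw [h', h]; simp

theorem IsTestFun.const_mul (c : ℝ) {φ : Euc n → ℝ} (hφ : IsTestFun n Ω φ) :
    IsTestFun n Ω fun y => c * φ y :=
  ⟨contDiff_const.mul hφ.1, hφ.2.1.mul_left,
    (closure_mono (Function.support_const_smul_subset c φ)).trans hφ.2.2⟩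

theorem isTestFun_zero : IsTestFun n Ω fun _ => 0 :=
  ⟨contDiff_const, HasCompactSupport.zero, by simp [tsupport]⟩

theorem IsTestFun.add {φ ψ : Euc n → ℝ} (hφ : IsTestFun n Ω φ) (hψ : IsTestFun n Ω ψ) :
    IsTestFun n Ω fun y => φ y + ψ y :=
  ⟨hφ.1.add hψ.1, hφ.2.1.add hψ.2.1,
    (tsupport_add φ ψ).trans (Set.union_subset hφ.2.2 hψ.2.2)⟩

theorem IsTestFun.sum {w : ℕ → Euc n → ℝ} (hw : ∀ j, IsTestFun n Ω (w j)) (k : ℕ) :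
    IsTestFun n Ω fun y => ∑ j ∈ Finset.range k, w j y := by
  induction k with
  | zero => simpa using isTestFun_zero
  | succ k ih => simpa [Finset.sum_range_succ] using ih.add (hw k)

theorem IsTestFun.integrable {φ : Euc n → ℝ} (hφ : IsTestFun n Ω φ) : Integrable φ :=
  hφ.1.continuous.integrable_of_hasCompactSupport hφ.2.1

theorem IsTestFun.integrable_lapl {φ : Euc n → ℝ} (hφ : IsTestFun n Ω φ) :
    Integrable (lapl n φ) := by
  unfold lapl
  refine integrable_finsetSum _ fun i _ => ?_
  refine Continuous.integrable_of_hasCompactSupport ?_ ?_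
  · have := hφ.1.continuous_iteratedFDeriv (m := 2) two_le_top
    exact (ContinuousMultilinearMap.apply ℝ (fun _ : Fin 2 => Euc n) ℝ _).continuous.comp this
  · exact (hφ.2.1.iteratedFDeriv 2).comp_left
      (g := fun L : ContinuousMultilinearMap ℝ (fun _ : Fin 2 => Euc n) ℝ => L _) rfl

theorem memW21Delta0_tsum {w : ℕ → Euc n → ℝ} (hw : ∀ j, IsTestFun n Ω (w j))
    (h0 : Summable fun j => ∫ x in Ω, |w j x|)
    (h1 : Summable fun j => ∫ x in Ω, |lapl n (w j) x|) :
    MemW21Delta0 n Ω (fun x => ∑' j, w j x) (fun x => ∑' j, lapl n (w j) x) := by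
  obtain ⟨a, b⟩ := tendsto_integral_abs_sum_sub_tsum
    (fun j => (hw j).integrable.integrableOn) h0
  obtain ⟨c, d⟩ := tendsto_integral_abs_sum_sub_tsum
    (fun j => (hw j).integrable_lapl.integrableOn) h1
  refine ⟨a, c, fun k y => ∑ j ∈ Finset.range k, w j y, IsTestFun.sum hw, b, ?_⟩
  simpa only [lapl_sum hw] using d

theorem IsTestFun.memW21Delta0 {φ : Euc n → ℝ} (hφ : IsTestFun n Ω φ) :
    MemW21Delta0 n Ω φ (lapl n φ) :=
  ⟨hφ.integrable.integrableOn, hφ.integrable_lapl.integrableOn, fun _ => φ, fun _ => hφ,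
    by simp, by simp⟩

end

section

variable {n : ℕ} {Ω : Set (Euc n)}

theorem decRearr_nonneg (u : Euc n → ℝ) (t : ℝ) : 0 ≤ decRearr n Ω u t :=
  Real.sInf_nonneg fun _ h => h.1

theorem volume_superlevel_eq_restrict (hΩo : IsOpen Ω) (u : Euc n → ℝ) (s : ℝ) :
    volume {x ∈ Ω | s < |u x|} = volume.restrict Ω {x | s < |u x|} := by
  rw [Measure.restrict_apply' hΩo.measurableSet, Set.inter_comm]; rfl

theorem decRearr_set_nonempty (hΩo : IsOpen Ω) (hV : volume Ω ≠ ∞) {u : Euc n → ℝ}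
    (hu : AEMeasurable u (volume.restrict Ω)) {t : ℝ} (ht : 0 < t) :
    {s : ℝ | 0 ≤ s ∧ volume {x ∈ Ω | s < |u x|} ≤ ENNReal.ofReal t}.Nonempty := by
  have : IsFiniteMeasure (volume.restrict Ω) := ⟨by simpa using hV.lt_top⟩
  have h := tendsto_measure_iInter_atTop (μ := volume.restrict Ω)
    (s := fun k : ℕ => {x | (k : ℝ) < |u x|})
    (fun k => (nullMeasurableSet_lt aemeasurable_const hu.abs))
    (fun i j hij x hx => lt_of_le_of_lt (by exact_mod_cast hij) (show (j : ℝ) < |u x| from hx))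
    ⟨0, measure_ne_top _ _⟩
  have he : ⋂ k : ℕ, {x | (k : ℝ) < |u x|} = ∅ := by
    ext x
    obtain ⟨k, hk⟩ := exists_nat_ge |u x|
    simp only [Set.mem_iInter, Set.mem_ofPred_eq, Set.mem_empty_iff_false, iff_false, not_forall,
      not_lt]
    exact ⟨k, hk⟩
  rw [he, measure_empty] at h
  obtain ⟨k, hk⟩ := (h.eventually (gt_mem_nhds (ENNReal.ofReal_pos.2 ht))).exists
  exact ⟨k, Nat.cast_nonneg k, by rw [volume_superlevel_eq_restrict hΩo]; exact hk.le⟩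

theorem lt_decRearr_iff (hΩo : IsOpen Ω) (hV : volume Ω ≠ ∞) {u : Euc n → ℝ}
    (hu : AEMeasurable u (volume.restrict Ω)) {s t : ℝ} (hs : 0 ≤ s) (ht : 0 < t) :
    s < decRearr n Ω u t ↔ ENNReal.ofReal t < volume {x ∈ Ω | s < |u x|} := by
  constructor
  · intro h
    by_contra! hc
    exact h.not_ge (csInf_le ⟨0, fun _ h => h.1⟩ ⟨hs, hc⟩)
  · intro h
    have hmono : Monotone fun k : ℕ => {x ∈ Ω | s + 1 / ((k : ℝ) + 1) < |u x|} :=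
      fun i j hij x hx => ⟨hx.1, lt_of_le_of_lt
        (by have := Nat.one_div_le_one_div (α := ℝ) hij; linarith) hx.2⟩
    have hU : {x ∈ Ω | s < |u x|} = ⋃ k : ℕ, {x ∈ Ω | s + 1 / ((k : ℝ) + 1) < |u x|} := by
      ext x
      simp only [Set.mem_ofPred_eq, Set.mem_iUnion]
      constructor
      · rintro ⟨hx, h⟩
        obtain ⟨k, hk⟩ := exists_nat_one_div_lt (sub_pos.2 h)
        exact ⟨k, hx, by linarith⟩
      · rintro ⟨k, hx, h⟩
        exact ⟨hx, by have := Nat.one_div_pos_of_nat (α := ℝ) (n := k); linarith⟩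
    rw [hU, hmono.measure_iUnion, lt_iSup_iff] at h
    obtain ⟨k, hk⟩ := h
    have h1 : s + 1 / ((k : ℝ) + 1) ≤ decRearr n Ω u t := by
      refine le_csInf (decRearr_set_nonempty hΩo hV hu ht) fun s' hs' => ?_
      by_contra! hc
      exact (hk.trans_le (measure_mono fun x (hx : x ∈ Ω ∧ _) =>
        (⟨hx.1, hc.trans hx.2⟩ : x ∈ Ω ∧ _ < _))).not_ge hs'.2
    have := Nat.one_div_pos_of_nat (α := ℝ) (n := k)
    linarith

theorem decRearr_antitone (hΩo : IsOpen Ω) (hV : volume Ω ≠ ∞) {u : Euc n → ℝ}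
    (hu : AEMeasurable u (volume.restrict Ω)) {s t : ℝ} (hs : 0 < s) (hst : s ≤ t) :
    decRearr n Ω u t ≤ decRearr n Ω u s :=
  csInf_le_csInf ⟨0, fun _ h => h.1⟩ (decRearr_set_nonempty hΩo hV hu hs)
    fun _ h => ⟨h.1, h.2.trans (ENNReal.ofReal_le_ofReal hst)⟩

/-- The decreasing rearrangement, set to zero off `(0, ∞)`. -/
def posRearr (n : ℕ) (Ω : Set (Euc n)) (u : Euc n → ℝ) (t : ℝ) : ℝ :=
  if 0 < t then decRearr n Ω u t else 0

theorem posRearr_nonneg (u : Euc n → ℝ) (t : ℝ) : 0 ≤ posRearr n Ω u t := by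
  unfold posRearr; split_ifs
  exacts [decRearr_nonneg u t, le_rfl]

theorem measurable_posRearr (hΩo : IsOpen Ω) (hV : volume Ω ≠ ∞) {u : Euc n → ℝ}
    (hu : AEMeasurable u (volume.restrict Ω)) : Measurable (posRearr n Ω u) := by
  refine measurable_of_Ioi fun s => ?_
  rcases lt_or_ge s 0 with hs | hs
  · convert MeasurableSet.univ
    exact Set.eq_univ_of_forall fun t => hs.trans_le (posRearr_nonneg u t)
  · have : posRearr n Ω u ⁻¹' Set.Ioi s =
        {t | 0 < t} ∩ {t | ENNReal.ofReal t < volume {x ∈ Ω | s < |u x|}} := by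
      ext t
      simp only [Set.mem_preimage, Set.mem_Ioi, posRearr, Set.mem_inter_iff, Set.mem_ofPred_eq]
      split_ifs with h
      · simp [h, lt_decRearr_iff hΩo hV hu hs h]
      · simp [h, hs]
    rw [this]
    exact (measurableSet_lt measurable_const measurable_id).inter
      (measurableSet_lt ENNReal.measurable_ofReal measurable_const)

/-- The volume of the part of `Ω` in the ball of radius `r` about `x₀`. -/
def ballVol (Ω : Set (Euc n)) (x₀ : Euc n) (r : ℝ) : ℝ :=
  volume.real (Ω ∩ Metric.ball x₀ r)

theorem ballVol_mono (hV : volume Ω ≠ ∞) (x₀ : Euc n) : Monotone (ballVol Ω x₀) :=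
  fun _ _ h => measureReal_mono (Set.inter_subset_inter_right _ (Metric.ball_subset_ball h))
    (measure_ne_top_of_subset Set.inter_subset_left hV)

theorem volume_real_ball (hn : 2 ≤ n) (x₀ : Euc n) {r : ℝ} (hr : 0 ≤ r) :
    volume.real (Metric.ball x₀ r) = r ^ n * volume.real (Metric.ball (0 : Euc n) 1) := by
  have : Nontrivial (Euc n) := by
    have : Nonempty (Fin n) := ⟨⟨0, by omega⟩⟩
    infer_instance
  rw [measureReal_def, Measure.addHaar_ball _ _ hr, ENNReal.toReal_mul,
    ENNReal.toReal_ofReal (by positivity), measureReal_def]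
  simp

theorem ballVol_le_add (hn : 2 ≤ n) (x₀ : Euc n) {r r' : ℝ} (hr : 0 ≤ r') (h : r' ≤ r) :
    ballVol Ω x₀ r ≤ ballVol Ω x₀ r' +
      (r ^ n - r' ^ n) * volume.real (Metric.ball (0 : Euc n) 1) := by
  have h1 : Ω ∩ Metric.ball x₀ r ⊆
      (Ω ∩ Metric.ball x₀ r') ∪ (Metric.ball x₀ r \ Metric.ball x₀ r') := by
    intro x hx
    by_cases hx' : x ∈ Metric.ball x₀ r'
    exacts [Or.inl ⟨hx.1, hx'⟩, Or.inr ⟨hx.2, hx'⟩]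
  have hfin : volume (Metric.ball x₀ r) ≠ ∞ := Metric.isBounded_ball.measure_lt_top.ne
  have hfin' : volume (Metric.ball x₀ r') ≠ ∞ := Metric.isBounded_ball.measure_lt_top.ne
  have h2 := measureReal_mono (μ := volume) h1 (measure_union_ne_top
    (measure_ne_top_of_subset Set.inter_subset_right hfin')
    (measure_ne_top_of_subset Set.sdiff_subset hfin))
  have h3 := measureReal_sdiff (μ := volume) (Metric.ball_subset_ball h (x := x₀))
    Metric.isOpen_ball.measurableSet hfin
  have h4 := measureReal_union_le (μ := volume) (Ω ∩ Metric.ball x₀ r')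
    (Metric.ball x₀ r \ Metric.ball x₀ r')
  rw [volume_real_ball hn _ hr, volume_real_ball hn _ (hr.trans h)] at h3
  unfold ballVol
  linarith

theorem continuousOn_ballVol (hn : 2 ≤ n) (hV : volume Ω ≠ ∞) (x₀ : Euc n) :
    ContinuousOn (ballVol Ω x₀) (Set.Ici 0) := by
  intro r hr
  set κ := volume.real (Metric.ball (0 : Euc n) 1)
  have hb : ∀ r' ∈ Set.Ici (0 : ℝ), |ballVol Ω x₀ r' - ballVol Ω x₀ r| ≤ |r' ^ n - r ^ n| * κ := by
    intro r' hr'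
    rw [Set.mem_Ici] at hr hr'
    rcases le_total r r' with h | h
    · rw [abs_of_nonneg (sub_nonneg.2 (ballVol_mono hV x₀ h)),
        abs_of_nonneg (sub_nonneg.2 (pow_le_pow_left₀ hr h n))]
      linarith [ballVol_le_add (Ω := Ω) hn x₀ hr h]
    · rw [abs_of_nonpos (sub_nonpos.2 (ballVol_mono hV x₀ h)),
        abs_of_nonpos (sub_nonpos.2 (pow_le_pow_left₀ hr' h n))]
      linarith [ballVol_le_add (Ω := Ω) hn x₀ hr' h]
  have hlim : Tendsto (fun r' : ℝ => |r' ^ n - r ^ n| * κ) (𝓝[Set.Ici 0] r) (𝓝 0) := by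
    have : Continuous fun r' : ℝ => |r' ^ n - r ^ n| * κ := by fun_prop
    simpa using (this.tendsto r).mono_left nhdsWithin_le_nhds
  rw [ContinuousWithinAt, tendsto_iff_dist_tendsto_zero]
  exact squeeze_zero' (Eventually.of_forall fun _ => dist_nonneg)
    (eventually_nhdsWithin_of_forall hb) hlim

theorem volume_ballVol_dist_lt (hn : 2 ≤ n) (hΩb : Bornology.IsBounded Ω) (x₀ : Euc n)
    {m : ℝ≥0∞} (hm : m ≤ volume Ω) :
    volume {x ∈ Ω | ENNReal.ofReal (ballVol Ω x₀ (dist x x₀)) < m} = m := by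
  have hV : volume Ω ≠ ∞ := hΩb.measure_lt_top.ne
  have hm' : m ≠ ∞ := ne_top_of_le_ne_top hV hm
  obtain ⟨R, hR0, hR⟩ : ∃ R, 0 ≤ R ∧ Ω ⊆ Metric.ball x₀ R := by
    obtain ⟨R, hR⟩ := hΩb.subset_ball x₀
    exact ⟨max R 0, le_max_right _ _, hR.trans (Metric.ball_subset_ball (le_max_left _ _))⟩
  have hG0 : ballVol Ω x₀ 0 = 0 := by simp [ballVol]
  have hGR : ballVol Ω x₀ R = (volume Ω).toReal := by
    rw [ballVol, Set.inter_eq_left.2 hR, measureReal_def]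
  have hcont : ContinuousOn (ballVol Ω x₀) (Set.Icc 0 R) :=
    (continuousOn_ballVol hn hV x₀).mono Set.Icc_subset_Ici_self
  have hmem : m.toReal ∈ Set.Icc (ballVol Ω x₀ 0) (ballVol Ω x₀ R) := by
    rw [hG0, hGR]
    exact ⟨ENNReal.toReal_nonneg, ENNReal.toReal_mono hV hm⟩
  obtain ⟨r₁, hr₁, hr₁m⟩ := intermediate_value_Icc hR0 hcont hmem
  have hcpt : IsCompact (Set.Icc 0 R ∩ ballVol Ω x₀ ⁻¹' {m.toReal}) :=
    isCompact_Icc.of_isClosed_subset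
      (hcont.preimage_isClosed_of_isClosed isClosed_Icc isClosed_singleton) Set.inter_subset_left
  obtain ⟨r₀, ⟨hr₀, hr₀m⟩, hleast⟩ := hcpt.exists_isLeast ⟨r₁, hr₁, hr₁m⟩
  have hr₀m : ballVol Ω x₀ r₀ = m.toReal := hr₀m
  have hset : {x ∈ Ω | ENNReal.ofReal (ballVol Ω x₀ (dist x x₀)) < m} = Ω ∩ Metric.ball x₀ r₀ := by
    ext x
    simp only [Set.mem_ofPred_eq, Set.mem_inter_iff, Metric.mem_ball, and_congr_right_iff]
    intro _
    rw [ENNReal.ofReal_lt_iff_lt_toReal (a := ballVol Ω x₀ (dist x x₀)) measureReal_nonneg hm']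
    constructor
    · intro h
      by_contra! hc
      have := ballVol_mono hV x₀ hc
      linarith
    · intro h
      refine lt_of_le_of_ne (hr₀m ▸ ballVol_mono hV x₀ h.le) fun he => h.not_ge ?_
      exact hleast ⟨⟨dist_nonneg, h.le.trans hr₀.2⟩, he⟩
  rw [hset, ← ENNReal.ofReal_toReal hm', ← hr₀m, ballVol, measureReal_def,
    ENNReal.ofReal_toReal (measure_ne_top_of_subset Set.inter_subset_left hV)]

theorem ballVol_pos (hΩo : IsOpen Ω) (hV : volume Ω ≠ ∞) {x₀ : Euc n} (hx₀ : x₀ ∈ Ω) {r : ℝ}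
    (hr : 0 < r) : 0 < ballVol Ω x₀ r :=
  ENNReal.toReal_pos ((hΩo.inter Metric.isOpen_ball).measure_pos volume
      ⟨x₀, hx₀, Metric.mem_ball_self hr⟩).ne'
    (measure_ne_top_of_subset Set.inter_subset_left hV)

theorem ae_ne_point (hn : 2 ≤ n) (x₀ : Euc n) : ∀ᵐ x : Euc n, x ≠ x₀ := by
  have : Nontrivial (Euc n) := by
    have : Nonempty (Fin n) := ⟨⟨0, by omega⟩⟩
    infer_instance
  exact Measure.ae_ne volume x₀

/-- The spherical rearrangement of `u` about `x₀` relative to `Ω`. -/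
def sphRearr (n : ℕ) (Ω : Set (Euc n)) (u : Euc n → ℝ) (x₀ x : Euc n) : ℝ :=
  posRearr n Ω u (ballVol Ω x₀ (dist x x₀))

theorem measurable_sphRearr (hΩo : IsOpen Ω) (hV : volume Ω ≠ ∞) {u : Euc n → ℝ}
    (hu : AEMeasurable u (volume.restrict Ω)) (x₀ : Euc n) : Measurable (sphRearr n Ω u x₀) :=
  (measurable_posRearr hΩo hV hu).comp
    ((ballVol_mono hV x₀).measurable.comp (measurable_id.dist measurable_const))

theorem volume_superlevel_sphRearr (hn : 2 ≤ n) (hΩo : IsOpen Ω) (hΩb : Bornology.IsBounded Ω)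
    {u : Euc n → ℝ} (hu : AEMeasurable u (volume.restrict Ω)) {x₀ : Euc n} (hx₀ : x₀ ∈ Ω) {s : ℝ}
    (hs : 0 ≤ s) :
    volume {x ∈ Ω | s < |sphRearr n Ω u x₀ x|} = volume {x ∈ Ω | s < |u x|} := by
  have hV : volume Ω ≠ ∞ := hΩb.measure_lt_top.ne
  rw [← volume_ballVol_dist_lt hn hΩb x₀ (m := volume {x ∈ Ω | s < |u x|})
    (measure_mono fun x hx => hx.1)]
  refine measure_congr ?_
  filter_upwards [ae_ne_point hn x₀] with x hx
  have hpos := ballVol_pos hΩo hV hx₀ (dist_pos.2 hx)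
  refine propext (and_congr_right fun _ => ?_)
  rw [sphRearr, abs_of_nonneg (posRearr_nonneg u _), posRearr, if_pos hpos,
    lt_decRearr_iff hΩo hV hu hs hpos]

end

section

variable {n : ℕ} {Ω : Set (Euc n)}

theorem exists_isTestFun_one_le (hΩo : IsOpen Ω) {K : Set (Euc n)} (hK : IsCompact K)
    (hKΩ : K ⊆ Ω) : ∃ φ, IsTestFun n Ω φ ∧ ∀ x ∈ K, 1 ≤ φ x := by
  obtain ⟨L, hL, hKL, hLΩ⟩ := exists_compact_between hK hΩo hKΩ
  obtain ⟨f, hfs, hf, hfr⟩ := IsOpen.exists_contDiff_support_eq (n := ⊤) (isOpen_interior (s := L))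
  have hts : tsupport f ⊆ L := by
    rw [tsupport, hfs]; exact closure_minimal interior_subset hL.isClosed
  have hf0 : ∀ x, 0 ≤ f x := fun x => (hfr ⟨x, rfl⟩).1
  have hft : IsTestFun n Ω f := ⟨hf, hL.of_isClosed_subset (isClosed_tsupport f) hts,
    hts.trans hLΩ⟩
  rcases K.eq_empty_or_nonempty with rfl | hne
  · exact ⟨f, hft, by simp⟩
  obtain ⟨x₁, hx₁, hmin⟩ := hK.exists_isMinOn hne hf.continuous.continuousOn
  have hpos : 0 < f x₁ := lt_of_le_of_ne (hf0 x₁) (Ne.symm (by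
    have : x₁ ∈ Function.support f := hfs ▸ hKL hx₁
    exact this))
  refine ⟨fun y => (f x₁)⁻¹ * f y, hft.const_mul _, fun x hx => ?_⟩
  change 1 ≤ (f x₁)⁻¹ * f x
  rw [inv_mul_eq_div, one_le_div hpos]
  exact hmin hx

theorem RISpace.indicator_compact_mem (hΩo : IsOpen Ω) (X : RISpace n Ω)
    (hW : ∀ u f : Euc n → ℝ, MemW21Delta0 n Ω u f → u ∈ X.carrier) {K E : Set (Euc n)}
    (hK : IsCompact K) (hKΩ : K ⊆ Ω) (hE : MeasurableSet E) (hEK : E ⊆ K) :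
    E.indicator (1 : Euc n → ℝ) ∈ X.carrier := by
  obtain ⟨φ, hφ, h1⟩ := exists_isTestFun_one_le hΩo hK hKΩ
  refine (X.ideal φ _ (hW _ _ hφ.memW21Delta0)
    (measurable_one.indicator hE).aemeasurable (ae_of_all _ fun x => ?_)).1
  by_cases hx : x ∈ E
  · simpa [hx] using (h1 x (hEK hx)).trans (le_abs_self _)
  · simp [hx]

theorem volume_superlevel_indicator {E : Set (Euc n)} (hE : E ⊆ Ω) (s : ℝ) (hs : 0 ≤ s) :
    volume {x ∈ Ω | s < |E.indicator (1 : Euc n → ℝ) x|} = if s < 1 then volume E else 0 := by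
  split_ifs with h
  · congr 1
    ext x
    by_cases hx : x ∈ E
    · simp [hx, h, hE hx]
    · simp [hx, hs]
  · convert measure_empty (μ := volume)
    refine Set.eq_empty_of_forall_notMem fun x hx => ?_
    have h2 := hx.2
    by_cases hx : x ∈ E
    · simp only [hx, Set.indicator_of_mem, Pi.one_apply, abs_one] at h2; exact h h2
    · simp only [hx, not_false_eq_true, Set.indicator_of_notMem, abs_zero] at h2; linarith

theorem RISpace.one_mem (hn : 2 ≤ n) (hΩo : IsOpen Ω) (hΩb : Bornology.IsBounded Ω)
    (X : RISpace n Ω) (hW : ∀ u f : Euc n → ℝ, MemW21Delta0 n Ω u f → u ∈ X.carrier)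
    {x₀ : Euc n} (hx₀ : x₀ ∈ Ω) : (1 : Euc n → ℝ) ∈ X.carrier := by
  have hV : volume Ω ≠ ∞ := hΩb.measure_lt_top.ne
  obtain ⟨δ, hδ, hδΩ⟩ := Metric.nhds_basis_closedBall.mem_iff.1 (hΩo.mem_nhds hx₀)
  have hG := ballVol_pos hΩo hV hx₀ hδ
  obtain ⟨K, hKΩ, hK, hKm⟩ := hΩo.measurableSet.exists_isCompact_sdiff_lt hV
    (ENNReal.ofReal_pos.2 hG).ne'
  set K' := K ∪ Metric.closedBall x₀ δ with hK'
  have hKc : IsCompact K' := hK.union (isCompact_closedBall x₀ δ)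
  have hKΩ' : K' ⊆ Ω := Set.union_subset hKΩ hδΩ
  have hm : volume (Ω \ K') < ENNReal.ofReal (ballVol Ω x₀ δ) :=
    (measure_mono (Set.sdiff_subset_sdiff_right Set.subset_union_left)).trans_lt hKm
  set E := {x ∈ Ω | ENNReal.ofReal (ballVol Ω x₀ (dist x x₀)) < volume (Ω \ K')} with hE
  have hEm : MeasurableSet E := hΩo.measurableSet.inter (measurableSet_lt
    (ENNReal.measurable_ofReal.comp ((ballVol_mono hV x₀).measurable.comp
      (measurable_id.dist measurable_const))) measurable_const)
  have hEK : E ⊆ K' := fun x hx => Or.inr (by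
    by_contra hc
    rw [Metric.mem_closedBall, not_le] at hc
    exact (hx.2.trans hm).not_ge (ENNReal.ofReal_le_ofReal (ballVol_mono hV x₀ hc.le)))
  have h1 := X.indicator_compact_mem hΩo hW hKc hKΩ' hKc.measurableSet subset_rfl
  have h2 := X.indicator_compact_mem hΩo hW hKc hKΩ' hEm hEK
  have hd : MeasurableSet (Ω \ K') := hΩo.measurableSet.diff hKc.measurableSet
  have h3 := (X.rearr_invariant _ ((Ω \ K').indicator 1) h2
    (measurable_one.indicator hd).aemeasurable fun s hs => by
      rw [volume_superlevel_indicator (hEK.trans hKΩ') s hs,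
        volume_superlevel_indicator Set.sdiff_subset s hs,
        volume_ballVol_dist_lt hn hΩb x₀ (measure_mono Set.sdiff_subset)]).1
  refine (X.ideal _ 1 (X.add_mem _ _ h1 h3) measurable_one.aemeasurable ?_).1
  refine (ae_restrict_iff' hΩo.measurableSet).2 (ae_of_all _ fun x hx => ?_)
  by_cases hxK : x ∈ K' <;> simp [hx, hxK]

end

section

variable {n : ℕ} {Ω : Set (Euc n)}

theorem intervalIntegrable_decRearr (hΩo : IsOpen Ω) (hV : volume Ω ≠ ∞) {u : Euc n → ℝ}
    (hu : AEMeasurable u (volume.restrict Ω)) {b : ℝ → ℝ} {t : ℝ} (ht : 0 < t)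
    (hb : IntervalIntegrable b volume 0 t)
    (hub : ∀ s ∈ Set.Ioc 0 t, decRearr n Ω u s ≤ b s) :
    IntervalIntegrable (decRearr n Ω u) volume 0 t := by
  rw [intervalIntegrable_iff_integrableOn_Ioc_of_le ht.le] at hb ⊢
  refine hb.mono' ?_ ?_
  · refine (measurable_posRearr hΩo hV hu).aestronglyMeasurable.congr ?_
    exact (ae_restrict_iff' measurableSet_Ioc).2 (ae_of_all _ fun s hs => by
      simp [posRearr, hs.1])
  · exact (ae_restrict_iff' measurableSet_Ioc).2 (ae_of_all _ fun s hs => by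
      rw [Real.norm_eq_abs, abs_of_nonneg (decRearr_nonneg u s)]; exact hub s hs)

theorem decRearr_le_maximalFn (hΩo : IsOpen Ω) (hV : volume Ω ≠ ∞) {u : Euc n → ℝ}
    (hu : AEMeasurable u (volume.restrict Ω)) {t : ℝ} (ht : 0 < t)
    (hint : IntervalIntegrable (decRearr n Ω u) volume 0 t) :
    decRearr n Ω u t ≤ maximalFn n Ω u t := by
  have h := intervalIntegral.integral_mono_on_of_le_Ioo ht.le
    (intervalIntegrable_const (c := decRearr n Ω u t)) hint
    (fun s hs => decRearr_antitone hΩo hV hu hs.1 hs.2.le)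
  rw [intervalIntegral.integral_const, smul_eq_mul, sub_zero] at h
  rw [maximalFn, one_div, inv_mul_eq_div, le_div_iff₀ ht]
  linarith

/-- The growth of the Newtonian kernel as a function of volume. -/
def kernelGrowth (n : ℕ) (t : ℝ) : ℝ :=
  if n = 2 then Real.log (1 / t) else t ^ (-(((n : ℝ) - 2) / (n : ℝ)))

theorem MemLambda0.eventually_decRearr_le (hn : 2 ≤ n) (hΩo : IsOpen Ω) (hV : volume Ω ≠ ∞)
    (hne : Ω.Nonempty) {u : Euc n → ℝ} (hu : AEMeasurable u (volume.restrict Ω))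
    (hL : MemLambda0 n Ω u) {ε : ℝ} (hε : 0 < ε) :
    ∀ᶠ t in 𝓝[>] (0 : ℝ), decRearr n Ω u t ≤ ε * kernelGrowth n t := by
  have hV0 : 0 < (volume Ω).toReal := ENNReal.toReal_pos (hΩo.measure_pos volume hne).ne' hV
  have hsmall : ∀ c : ℝ, 0 < c → ∀ᶠ t in 𝓝[>] (0 : ℝ), 0 < t ∧ t < c := fun c hc =>
    Ioo_mem_nhdsGT hc
  unfold MemLambda0 at hL
  unfold kernelGrowth
  split_ifs at hL ⊢ with h2
  · obtain ⟨⟨M, hM⟩, hlim⟩ := hL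
    filter_upwards [hlim.eventually (gt_mem_nhds hε), hsmall _ hV0, hsmall 1 one_pos] with
      t h1 h3 h4
    have hlog : 0 < Real.log (1 / t) := Real.log_pos (by
      rw [lt_div_iff₀ h3.1]; linarith [h4.2])
    rw [div_lt_iff₀ hlog] at h1
    refine (decRearr_le_maximalFn hΩo hV hu h3.1 ?_).trans h1.le
    refine intervalIntegrable_decRearr hΩo hV hu h3.1
      (b := fun s => M * (1 + (Real.log (volume Ω).toReal - Real.log s))) ?_ fun s hs => ?_
    · exact (intervalIntegrable_const.add
        (intervalIntegrable_const.sub intervalIntegral.intervalIntegrable_log')).const_mul M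
    · have hsV : s ≤ (volume Ω).toReal := hs.2.trans h3.2.le
      have h0 : 0 ≤ Real.log ((volume Ω).toReal / s) := Real.log_nonneg (by
        rwa [le_div_iff₀ hs.1, one_mul])
      have := hM s hs.1 hsV
      rw [div_le_iff₀ (by linarith)] at this
      rwa [Real.log_div hV0.ne' hs.1.ne'] at this
  · obtain ⟨⟨M, hM⟩, hlim⟩ := hL
    have hn' : (2 : ℝ) ≤ n := by exact_mod_cast hn
    filter_upwards [hlim.eventually (gt_mem_nhds hε), hsmall _ hV0] with t h1 h3
    have hpow : 0 < t ^ (((n : ℝ) - 2) / n) := Real.rpow_pos_of_pos h3.1 _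
    rw [Real.rpow_neg h3.1.le, ← div_eq_mul_inv, le_div_iff₀ hpow]
    refine le_trans ?_ h1.le
    rw [mul_comm]
    refine mul_le_mul_of_nonneg_left (decRearr_le_maximalFn hΩo hV hu h3.1 ?_) hpow.le
    refine intervalIntegrable_decRearr hΩo hV hu h3.1
      (b := fun s => M * s ^ (-(((n : ℝ) - 2) / n))) ?_ fun s hs => ?_
    · refine (intervalIntegral.intervalIntegrable_rpow' ?_).const_mul M
      rw [neg_lt_neg_iff, div_lt_one (by linarith)]; linarith
    · rw [Real.rpow_neg hs.1.le, ← div_eq_mul_inv, le_div_iff₀ (Real.rpow_pos_of_pos hs.1 _),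
        mul_comm]
      exact hM s hs.1 (hs.2.trans h3.2.le)

end

section

/-- A smooth cutoff equal to one on `(-∞, a]` and to zero on `[2a, ∞)`. -/
def cutoff (a y : ℝ) : ℝ := Real.smoothTransition (2 - y / a)

theorem cutoff_contDiff (a : ℝ) : ContDiff ℝ (⊤ : ℕ∞) (cutoff a) :=
  Real.smoothTransition.contDiff.comp (contDiff_const.sub (contDiff_id.div_const a))

theorem cutoff_eq_one {a y : ℝ} (ha : 0 < a) (h : y ≤ a) : cutoff a y = 1 :=
  Real.smoothTransition.one_of_one_le (by
    have := (div_le_one ha).2 h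
    linarith)

theorem cutoff_eq_zero {a y : ℝ} (ha : 0 < a) (h : 2 * a ≤ y) : cutoff a y = 0 :=
  Real.smoothTransition.zero_of_nonpos (by
    have := (le_div_iff₀ ha).2 h
    linarith)

theorem cutoff_nonneg (a y : ℝ) : 0 ≤ cutoff a y := Real.smoothTransition.nonneg _

theorem cutoff_le_one (a y : ℝ) : cutoff a y ≤ 1 := Real.smoothTransition.le_one _

/-- The cut-off density `y ^ (-n/2)`. -/
def kerDensity (n : ℕ) (a y : ℝ) : ℝ := y ^ (-((n : ℝ) / 2)) * cutoff a y

/-- The primitive of `kerDensity` vanishing at infinity; as a function of the squared radius it is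
a cut-off Newtonian kernel. -/
def kerProfile (n : ℕ) (a s : ℝ) : ℝ := ∫ y in s..2 * a, kerDensity n a y

variable {n : ℕ} {a : ℝ}

theorem kerDensity_nonneg {y : ℝ} (hy : 0 < y) : 0 ≤ kerDensity n a y :=
  mul_nonneg (Real.rpow_nonneg hy.le _) (cutoff_nonneg a y)

theorem kerDensity_le {y : ℝ} (hy : 0 < y) : kerDensity n a y ≤ y ^ (-((n : ℝ) / 2)) :=
  mul_le_of_le_one_right (Real.rpow_nonneg hy.le _) (cutoff_le_one a y)

theorem kerDensity_contDiffOn : ContDiffOn ℝ (⊤ : ℕ∞) (kerDensity n a) (Set.Ioi 0) := by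
  refine ContDiffOn.mul (fun y hy => ?_) (cutoff_contDiff a).contDiffOn
  exact (Real.contDiffAt_rpow_const_of_ne (ne_of_gt hy)).contDiffWithinAt

theorem kerDensity_intervalIntegrable {s t : ℝ} (hs : 0 < s) (ht : 0 < t) :
    IntervalIntegrable (kerDensity n a) volume s t :=
  (kerDensity_contDiffOn.continuousOn.mono fun _ hy =>
    (lt_min hs ht).trans_le hy.1).intervalIntegrable

theorem kerProfile_hasDerivAt (ha : 0 < a) {s : ℝ} (hs : 0 < s) :
    HasDerivAt (kerProfile n a) (-kerDensity n a s) s := by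
  have hc : ContinuousOn (kerDensity n a) (Set.Ioi 0) := kerDensity_contDiffOn.continuousOn
  exact intervalIntegral.integral_hasDerivAt_left
    (kerDensity_intervalIntegrable hs (by positivity))
    (hc.stronglyMeasurableAtFilter isOpen_Ioi s hs) (hc.continuousAt (Ioi_mem_nhds hs))

theorem kerProfile_contDiffOn (ha : 0 < a) :
    ContDiffOn ℝ (⊤ : ℕ∞) (kerProfile n a) (Set.Ioi 0) := by
  refine (contDiffOn_infty_iff_deriv_of_isOpen isOpen_Ioi).2 ⟨fun s hs =>
    (kerProfile_hasDerivAt ha hs).differentiableAt.differentiableWithinAt, ?_⟩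
  exact kerDensity_contDiffOn.neg.congr fun s hs => (kerProfile_hasDerivAt ha hs).deriv

theorem kerProfile_eq_zero (ha : 0 < a) {s : ℝ} (hs : 2 * a ≤ s) : kerProfile n a s = 0 := by
  rw [kerProfile, intervalIntegral.integral_symm, intervalIntegral.integral_congr (g := fun _ => 0)]
  · simp
  · intro y hy
    rw [Set.uIcc_of_le hs] at hy
    simp [kerDensity, cutoff_eq_zero ha hy.1]

theorem kerProfile_antitone (ha : 0 < a) {s t : ℝ} (hs : 0 < s) (hst : s ≤ t) :
    kerProfile n a t ≤ kerProfile n a s := by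
  have h2a : 0 < 2 * a := by positivity
  have h := intervalIntegral.integral_add_adjacent_intervals
    (kerDensity_intervalIntegrable (n := n) (a := a) hs (hs.trans_le hst))
    (kerDensity_intervalIntegrable (n := n) (a := a) (hs.trans_le hst) h2a)
  have h0 : 0 ≤ ∫ y in s..t, kerDensity n a y :=
    intervalIntegral.integral_nonneg hst fun y hy => kerDensity_nonneg (hs.trans_le hy.1)
  unfold kerProfile
  linarith

theorem kerProfile_nonneg (ha : 0 < a) {s : ℝ} (hs : 0 < s) : 0 ≤ kerProfile n a s := by
  rw [← kerProfile_eq_zero (n := n) ha (le_max_right s (2 * a))]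
  exact kerProfile_antitone ha hs (le_max_left _ _)

theorem integral_le_kerProfile (ha : 0 < a) {s t : ℝ} (hs : 0 < s) (hst : s ≤ t) (ht : t ≤ a) :
    ∫ y in s..t, y ^ (-((n : ℝ) / 2)) ≤ kerProfile n a s := by
  have h2a : 0 < 2 * a := by positivity
  have h := intervalIntegral.integral_add_adjacent_intervals
    (kerDensity_intervalIntegrable (n := n) (a := a) hs (hs.trans_le hst))
    (kerDensity_intervalIntegrable (n := n) (a := a) (hs.trans_le hst) h2a)
  have h0 : 0 ≤ kerProfile n a t := kerProfile_nonneg ha (hs.trans_le hst)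
  have h1 : ∫ y in s..t, y ^ (-((n : ℝ) / 2)) = ∫ y in s..t, kerDensity n a y := by
    refine intervalIntegral.integral_congr fun y hy => ?_
    rw [Set.uIcc_of_le hst] at hy
    simp [kerDensity, cutoff_eq_one ha (hy.2.trans ht)]
  unfold kerProfile at h0 ⊢
  linarith

theorem log_le_kerProfile (ha : 0 < a) {s : ℝ} (hs : 0 < s) (hsa : s ≤ a) :
    Real.log (a / s) ≤ kerProfile 2 a s := by
  refine le_trans (le_of_eq ?_) (integral_le_kerProfile ha hs hsa le_rfl)
  rw [← integral_inv_of_pos hs ha]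
  refine intervalIntegral.integral_congr fun y hy => ?_
  norm_num [Real.rpow_neg_one]

theorem rpow_le_kerProfile (ha : 0 < a) {s : ℝ} (hs : 0 < s) (hsa : 2 * s ≤ a) :
    s * (2 * s) ^ (-((n : ℝ) / 2)) ≤ kerProfile n a s := by
  have hs2 : s ≤ 2 * s := by linarith
  refine le_trans ?_ (integral_le_kerProfile ha hs hs2 hsa)
  have h := intervalIntegral.integral_mono_on (μ := volume) hs2
    (intervalIntegrable_const (c := (2 * s) ^ (-((n : ℝ) / 2))))
    (g := fun y => y ^ (-((n : ℝ) / 2)))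
    (ContinuousOn.intervalIntegrable fun y hy => by
      rw [Set.uIcc_of_le hs2] at hy
      exact (Real.continuousAt_rpow_const _ _
        (Or.inl (hs.trans_le hy.1).ne')).continuousWithinAt) fun y hy =>
      Real.rpow_le_rpow_of_nonpos (hs.trans_le hy.1) hy.2 (by
        have : (0 : ℝ) ≤ n := Nat.cast_nonneg n
        linarith)
  rw [intervalIntegral.integral_const, smul_eq_mul] at h
  linarith

theorem kerProfile_le (hn : 1 ≤ n) (ha : 0 < a) {s : ℝ} (hs : 0 < s) :
    kerProfile n a s ≤ (∫ y in (0 : ℝ)..2 * a, y ^ (-(1 / 2) : ℝ)) *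
      s ^ (-(((n : ℝ) - 1) / 2)) := by
  have h2a : 0 < 2 * a := by positivity
  have hint : ∀ b c : ℝ, IntervalIntegrable (fun y : ℝ => y ^ (-(1 / 2) : ℝ)) volume b c :=
    fun b c => intervalIntegral.intervalIntegrable_rpow' (by norm_num)
  have hnn : ∀ y : ℝ, 0 ≤ y → 0 ≤ y ^ (-(1 / 2) : ℝ) := fun y hy => Real.rpow_nonneg hy _
  have hs0 : 0 ≤ s ^ (-(((n : ℝ) - 1) / 2)) := Real.rpow_nonneg hs.le _
  rcases le_total s (2 * a) with h | h
  · have h1 : kerProfile n a s ≤ ∫ y in s..2 * a, y ^ (-(1 / 2) : ℝ) * s ^ (-(((n : ℝ) - 1) / 2)) := by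
      refine intervalIntegral.integral_mono_on h (kerDensity_intervalIntegrable hs h2a)
        ((hint _ _).mul_const _) fun y hy => ?_
      have hy0 : 0 < y := hs.trans_le hy.1
      refine (kerDensity_le hy0).trans ?_
      have he : -((n : ℝ) / 2) = -(1 / 2) + -(((n : ℝ) - 1) / 2) := by ring
      rw [he, Real.rpow_add hy0]
      refine mul_le_mul_of_nonneg_left (Real.rpow_le_rpow_of_nonpos hs hy.1 ?_) (hnn y hy0.le)
      have : (1 : ℝ) ≤ n := by exact_mod_cast hn
      linarith
    rw [intervalIntegral.integral_mul_const] at h1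
    refine h1.trans (mul_le_mul_of_nonneg_right ?_ hs0)
    rw [← intervalIntegral.integral_add_adjacent_intervals (hint 0 s) (hint s (2 * a))]
    have := intervalIntegral.integral_nonneg (μ := volume) hs.le fun y hy => hnn y hy.1
    linarith
  · rw [kerProfile_eq_zero ha h]
    exact mul_nonneg (intervalIntegral.integral_nonneg h2a.le fun y hy => hnn y hy.1) hs0

theorem kerDensity_hasDerivAt {y : ℝ} (hy : 0 < y) :
    HasDerivAt (kerDensity n a) (-((n : ℝ) / 2) * y ^ (-((n : ℝ) / 2) - 1) * cutoff a y +
      y ^ (-((n : ℝ) / 2)) * deriv (cutoff a) y) y :=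
  (Real.hasDerivAt_rpow_const (Or.inl hy.ne')).mul
    ((cutoff_contDiff a).differentiable (by simp) y).hasDerivAt

theorem exists_bound_deriv_cutoff (n : ℕ) (ha : 0 < a) :
    ∃ D, ∀ s, 0 < s → |4 * s * (s ^ (-((n : ℝ) / 2)) * deriv (cutoff a) s)| ≤ D := by
  have hc : ContinuousOn (fun s : ℝ => 4 * s * (s ^ (-((n : ℝ) / 2)) * deriv (cutoff a) s))
      (Set.Icc a (2 * a)) := by
    refine ContinuousOn.mul (by fun_prop) (ContinuousOn.mul (fun y hy => ?_)
      ((cutoff_contDiff a).continuous_deriv (by simp)).continuousOn)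
    exact (Real.continuousAt_rpow_const _ _
        (Or.inl (ha.trans_le hy.1).ne')).continuousWithinAt
  obtain ⟨D, hD⟩ := isCompact_Icc.exists_bound_of_continuousOn hc
  refine ⟨max D 0, fun s hs => ?_⟩
  rcases lt_or_ge s a with h | h
  · have : deriv (cutoff a) s = 0 := by
      have he : cutoff a =ᶠ[𝓝 s] fun _ => 1 := by
        filter_upwards [Iio_mem_nhds h] with y hy using cutoff_eq_one ha (le_of_lt hy)
      rw [he.deriv_eq, deriv_const]
    simp [this]
  rcases lt_or_ge (2 * a) s with h' | h'
  · have : deriv (cutoff a) s = 0 := by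
      have he : cutoff a =ᶠ[𝓝 s] fun _ => 0 := by
        filter_upwards [Ioi_mem_nhds h'] with y hy using cutoff_eq_zero ha (le_of_lt hy)
      rw [he.deriv_eq, deriv_const]
    simp [this]
  · exact (hD s ⟨h, h'⟩).trans (le_max_left _ _)

/-- The regularized cut-off Newtonian kernel with pole `x₀`. -/
def regKer (n : ℕ) (a : ℝ) (x₀ : Euc n) (r : ℝ) (x : Euc n) : ℝ :=
  kerProfile n a (‖x - x₀‖ ^ 2 + r ^ 2)

theorem regKer_isTestFun {Ω : Set (Euc n)} (ha : 0 < a) {x₀ : Euc n} {δ : ℝ} (hδ : 0 ≤ δ)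
    (hδa : 2 * a = δ ^ 2) (hΩ : Metric.closedBall x₀ δ ⊆ Ω) {r : ℝ} (hr : 0 < r) :
    IsTestFun n Ω (regKer n a x₀ r) := by
  have hts : tsupport (regKer n a x₀ r) ⊆ Metric.closedBall x₀ δ := by
    refine closure_minimal (fun x hx => ?_) Metric.isClosed_closedBall
    by_contra hc
    rw [Metric.mem_closedBall, not_le, dist_eq_norm] at hc
    refine hx (kerProfile_eq_zero ha ?_)
    have := pow_le_pow_left₀ hδ hc.le 2
    nlinarith [sq_nonneg r]
  refine ⟨?_, (isCompact_closedBall x₀ δ).of_isClosed_subset (isClosed_tsupport _) hts,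
    hts.trans hΩ⟩
  have hq : ContDiff ℝ (⊤ : ℕ∞) fun x : Euc n => ‖x - x₀‖ ^ 2 + r ^ 2 :=
    ((contDiff_id.sub contDiff_const).norm_sq ℝ).add contDiff_const
  refine contDiffOn_univ.1 ((kerProfile_contDiffOn ha).comp hq.contDiffOn fun x _ => ?_)
  change 0 < ‖x - x₀‖ ^ 2 + r ^ 2
  positivity

theorem hasFDerivAt_sq_norm_sub (x₀ x : Euc n) (c : ℝ) :
    HasFDerivAt (fun y : Euc n => ‖y - x₀‖ ^ 2 + c) ((2 : ℝ) • innerSL ℝ (x - x₀)) x := by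
  have := ((hasFDerivAt_id x).sub_const x₀).norm_sq.add_const c
  refine this.congr_fderiv ?_
  ext y; simp [two_smul]

theorem regKer_hasFDerivAt (ha : 0 < a) (x₀ : Euc n) {r : ℝ} (hr : 0 < r) (x : Euc n) :
    HasFDerivAt (regKer n a x₀ r)
      ((-2 * kerDensity n a (‖x - x₀‖ ^ 2 + r ^ 2)) • innerSL ℝ (x - x₀)) x := by
  have hpos : 0 < ‖x - x₀‖ ^ 2 + r ^ 2 := by positivity
  have := (kerProfile_hasDerivAt (n := n) ha hpos).comp_hasFDerivAt x
    (hasFDerivAt_sq_norm_sub x₀ x (r ^ 2))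
  refine this.congr_fderiv ?_
  rw [smul_smul]; congr 1; ring

theorem lapl_regKer (ha : 0 < a) (x₀ : Euc n) {r : ℝ} (hr : 0 < r) (x : Euc n) {s : ℝ}
    (hs : s = ‖x - x₀‖ ^ 2 + r ^ 2) :
    lapl n (regKer n a x₀ r) x = -(2 * n * r ^ 2 * (s ^ (-((n : ℝ) / 2) - 1) * cutoff a s)) -
      4 * ‖x - x₀‖ ^ 2 * (s ^ (-((n : ℝ) / 2)) * deriv (cutoff a) s) := by
  have hpos : 0 < ‖x - x₀‖ ^ 2 + r ^ 2 := by positivity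
  have hf : fderiv ℝ (regKer n a x₀ r) =
      fun x => (-2 * kerDensity n a (‖x - x₀‖ ^ 2 + r ^ 2)) • innerSL ℝ (x - x₀) :=
    funext fun x => (regKer_hasFDerivAt ha x₀ hr x).fderiv
  set p' := -((n : ℝ) / 2) * s ^ (-((n : ℝ) / 2) - 1) * cutoff a s +
      s ^ (-((n : ℝ) / 2)) * deriv (cutoff a) s with hp'
  have hd : HasDerivAt (kerDensity n a) p' (‖x - x₀‖ ^ 2 + r ^ 2) := by
    rw [hp', hs]; exact kerDensity_hasDerivAt hpos
  have h1 := (hd.comp_hasFDerivAt x (hasFDerivAt_sq_norm_sub x₀ x (r ^ 2))).const_mul (-2)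
  have h2 : HasFDerivAt (fun y : Euc n => innerSL ℝ (y - x₀)) (innerSL ℝ : Euc n →L[ℝ] _) x :=
    (innerSL ℝ : Euc n →L[ℝ] Euc n →L[ℝ] ℝ).hasFDerivAt.comp x ((hasFDerivAt_id x).sub_const x₀)
  have h3 := (h1.smul h2).fderiv
  have h4 : ∀ i : Fin n, iteratedFDeriv ℝ 2 (regKer n a x₀ r) x
      ![EuclideanSpace.single i (1 : ℝ), EuclideanSpace.single i (1 : ℝ)] =
      -4 * p' * (x - x₀) i ^ 2 - 2 * kerDensity n a s := by
    intro i
    rw [iteratedFDeriv_two_apply, hf]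
    refine (congrArg (fun L : Euc n →L[ℝ] Euc n →L[ℝ] ℝ =>
      L (EuclideanSpace.single i (1 : ℝ)) (EuclideanSpace.single i (1 : ℝ))) h3).trans ?_
    have hone : innerSL ℝ (EuclideanSpace.single i (1 : ℝ)) (EuclideanSpace.single i (1 : ℝ)) =
        (1 : ℝ) := by
      rw [innerSL_apply_apply]; simp
    simp [← hs, EuclideanSpace.inner_single_right, hone]
    ring
  rw [lapl, Finset.sum_congr rfl fun i _ => h4 i, Finset.sum_sub_distrib, ← Finset.mul_sum,
    ← EuclideanSpace.real_norm_sq_eq, Finset.sum_const, Finset.card_univ, Fintype.card_fin,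
    nsmul_eq_mul, hp', kerDensity]
  have hs0 : 0 < s := hs ▸ hpos
  have hsp : s ^ (-((n : ℝ) / 2)) = s ^ (-((n : ℝ) / 2) - 1) * s := by
    rw [← Real.rpow_add_one hs0.ne']; ring_nf
  have hx : ‖x - x₀‖ ^ 2 = s - r ^ 2 := by rw [hs]; ring
  rw [hx, hsp]
  ring

end

section

variable {n : ℕ} {Ω : Set (Euc n)} {a : ℝ}

theorem rescaled_kernel_eq (x₀ x : Euc n) {r : ℝ} (hr : 0 < r) :
    r ^ 2 * (‖x - x₀‖ ^ 2 + r ^ 2) ^ (-((n : ℝ) / 2) - 1) =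
      (r ^ n)⁻¹ * (1 + ‖r⁻¹ • (x - x₀)‖ ^ 2) ^ (-((n : ℝ) + 2) / 2) := by
  have h1 : ‖x - x₀‖ ^ 2 + r ^ 2 = r ^ 2 * (1 + ‖r⁻¹ • (x - x₀)‖ ^ 2) := by
    rw [norm_smul, Real.norm_of_nonneg (inv_pos.2 hr).le]
    field_simp
    ring
  have h2 : (r ^ 2) ^ (-((n : ℝ) / 2) - 1) = (r ^ n)⁻¹ * (r ^ 2)⁻¹ := by
    rw [← Real.rpow_natCast r 2, ← Real.rpow_natCast r n, ← Real.rpow_mul hr.le,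
      ← Real.rpow_neg hr.le, ← Real.rpow_neg hr.le, ← Real.rpow_add hr]
    congr 1; push_cast; ring
  rw [h1, Real.mul_rpow (by positivity) (by positivity), h2,
    show -((n : ℝ) / 2) - 1 = -((n : ℝ) + 2) / 2 by ring]
  field_simp

theorem exists_bound_integral_lapl_regKer (hV : volume Ω ≠ ∞) (ha : 0 < a)
    (x₀ : Euc n) {δ : ℝ} (hδ : 0 ≤ δ) (hδa : 2 * a = δ ^ 2)
    (hΩ : Metric.closedBall x₀ δ ⊆ Ω) :
    ∃ C, ∀ r, 0 < r → ∫ x in Ω, |lapl n (regKer n a x₀ r) x| ≤ C := by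
  obtain ⟨D, hD⟩ := exists_bound_deriv_cutoff n ha
  set f : Euc n → ℝ := fun y => (1 + ‖y‖ ^ 2) ^ (-((n : ℝ) + 2) / 2) with hf
  have hfi : Integrable f := integrable_rpow_neg_one_add_norm_sq (by simp)
  have hfin : IsFiniteMeasure (volume.restrict Ω) := ⟨by simpa using hV.lt_top⟩
  refine ⟨2 * n * (∫ y, f y) + volume.real Ω * D, fun r hr => ?_⟩
  set g : Euc n → ℝ := fun x => 2 * n * ((r ^ n)⁻¹ * f (r⁻¹ • (x - x₀))) with hg
  have hgi : Integrable g :=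
    (((hfi.comp_smul (inv_pos.2 hr).ne').comp_sub_right x₀).const_mul _).const_mul _
  have hg0 : ∀ x, 0 ≤ g x := fun x => by positivity
  have hgint : ∫ x, g x = 2 * n * ∫ y, f y := by
    rw [hg, integral_const_mul, integral_const_mul,
      integral_sub_right_eq_self (fun x => f (r⁻¹ • x)) x₀,
      Measure.integral_comp_inv_smul_of_nonneg _ _ hr.le]
    simp only [finrank_euclideanSpace_fin, smul_eq_mul]
    field_simp
  have hpt : ∀ x, |lapl n (regKer n a x₀ r) x| ≤ g x + D := fun x => by
    set s := ‖x - x₀‖ ^ 2 + r ^ 2 with hs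
    have hs0 : 0 < s := by positivity
    rw [lapl_regKer ha x₀ hr x hs]
    refine (abs_sub _ _).trans (add_le_add ?_ (le_trans ?_ (hD s hs0)))
    · rw [abs_neg, abs_of_nonneg (by have := cutoff_nonneg a s; positivity), hg]
      dsimp only
      rw [hf]; dsimp only
      rw [← rescaled_kernel_eq x₀ x hr, ← hs]
      have h0 : 0 ≤ 2 * n * r ^ 2 * s ^ (-((n : ℝ) / 2) - 1) := by positivity
      nlinarith [mul_le_mul_of_nonneg_left (cutoff_le_one a s) h0]
    · rw [abs_mul, abs_mul (4 * s)]
      refine mul_le_mul_of_nonneg_right ?_ (abs_nonneg _)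
      rw [abs_of_nonneg (by positivity), abs_of_nonneg (by positivity)]
      nlinarith [sq_nonneg r]
  calc ∫ x in Ω, |lapl n (regKer n a x₀ r) x| ≤ ∫ x in Ω, (g x + D) :=
        integral_mono (regKer_isTestFun ha hδ hδa hΩ hr).integrable_lapl.integrableOn.abs
          (hgi.integrableOn.add (integrable_const D)) hpt
    _ = (∫ x in Ω, g x) + volume.real Ω * D := by
        rw [integral_add hgi.integrableOn (integrable_const D)]
        simp
    _ ≤ _ := by
        rw [← hgint]
        exact add_le_add (setIntegral_le_integral hgi (ae_of_all _ hg0)) le_rfl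

theorem integrable_indicator_norm_rpow (hn : 2 ≤ n) (δ : ℝ) :
    Integrable fun x : Euc n => (Set.Iic δ).indicator (fun y => y ^ (-((n : ℝ) - 1))) ‖x‖ := by
  have : Nontrivial (Euc n) := by
    have : Nonempty (Fin n) := ⟨⟨0, by omega⟩⟩
    infer_instance
  rw [integrable_fun_norm_addHaar volume (f := (Set.Iic δ).indicator fun y : ℝ => y ^ (-((n : ℝ) - 1))),
    finrank_euclideanSpace_fin]
  have h : IntegrableOn ((Set.Iic δ).indicator fun _ : ℝ => (1 : ℝ)) (Set.Ioi 0) := by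
    rw [IntegrableOn, integrable_indicator_iff measurableSet_Iic, IntegrableOn,
      Measure.restrict_restrict measurableSet_Iic, Set.Iic_inter_Ioi]
    exact integrableOn_const (by simp)
  refine h.congr_fun (fun y hy => ?_) measurableSet_Ioi
  rw [Set.mem_Ioi] at hy
  by_cases hyδ : y ≤ δ
  · simp only [Set.indicator_of_mem (Set.mem_Iic.2 hyδ), smul_eq_mul]
    rw [← Real.rpow_natCast, ← Real.rpow_add hy, Nat.cast_sub (by omega)]
    simp
  · simp [hyδ]

theorem exists_bound_integral_regKer (hn : 2 ≤ n) (ha : 0 < a)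
    (x₀ : Euc n) {δ : ℝ} (hδ : 0 ≤ δ) (hδa : 2 * a = δ ^ 2)
    (hΩ : Metric.closedBall x₀ δ ⊆ Ω) :
    ∃ C, ∀ r, 0 < r → ∫ x in Ω, |regKer n a x₀ r x| ≤ C := by
  set c := ∫ y in (0 : ℝ)..2 * a, y ^ (-(1 / 2) : ℝ)
  have hc : 0 ≤ c := intervalIntegral.integral_nonneg (by positivity) fun y hy =>
    Real.rpow_nonneg hy.1 _
  set g : Euc n → ℝ := fun x =>
    c * (Set.Iic δ).indicator (fun y => y ^ (-((n : ℝ) - 1))) ‖x - x₀‖ with hg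
  have hgi : Integrable g :=
    ((integrable_indicator_norm_rpow hn δ).comp_sub_right x₀).const_mul c
  have hg0 : ∀ x, 0 ≤ g x := fun x => mul_nonneg hc
    (Set.indicator_apply_nonneg fun _ => Real.rpow_nonneg (norm_nonneg _) _)
  refine ⟨∫ x, g x, fun r hr => ?_⟩
  have hpt : ∀ᵐ x, |regKer n a x₀ r x| ≤ g x := by
    filter_upwards [ae_ne_point hn x₀] with x hx
    have hx0 : 0 < ‖x - x₀‖ := norm_pos_iff.2 (sub_ne_zero.2 hx)
    rw [regKer, abs_of_nonneg (kerProfile_nonneg ha (by positivity)), hg]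
    by_cases h : ‖x - x₀‖ ≤ δ
    · simp only [Set.indicator_of_mem (Set.mem_Iic.2 h)]
      refine (kerProfile_antitone ha (s := ‖x - x₀‖ ^ 2) (by positivity)
        (by nlinarith [sq_nonneg r])).trans ((kerProfile_le (by omega) ha (by positivity)).trans
        (le_of_eq ?_))
      congr 1
      rw [← Real.rpow_natCast, ← Real.rpow_mul hx0.le]
      congr 1; push_cast; ring
    · rw [kerProfile_eq_zero ha]
      · simp [h]
      · rw [hδa]; push Not at h; nlinarith [sq_nonneg r]
  exact (integral_mono_ae (regKer_isTestFun ha hδ hδa hΩ hr).integrable.integrableOn.abs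
    hgi.integrableOn (ae_restrict_of_ae hpt)).trans
    (setIntegral_le_integral hgi (ae_of_all _ hg0))

end

section

variable {n : ℕ} {Ω : Set (Euc n)} {a : ℝ}

theorem eventually_kernelGrowth_le (hn : 2 ≤ n) (ha : 0 < a) {κ : ℝ} (hκ : 0 < κ) :
    ∃ C, 0 < C ∧ ∀ᶠ ρ in 𝓝[>] (0 : ℝ),
      kernelGrowth n (κ * ρ ^ n) ≤ C * kerProfile n a (2 * ρ ^ 2) := by
  have hsmall : ∀ c : ℝ, 0 < c → ∀ᶠ ρ in 𝓝[>] (0 : ℝ), 4 * ρ ^ 2 < c := fun c hc => by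
    have h : Tendsto (fun ρ : ℝ => 4 * ρ ^ 2) (𝓝[>] 0) (𝓝 0) :=
      tendsto_nhdsWithin_of_tendsto_nhds ((by fun_prop : Continuous fun ρ : ℝ => 4 * ρ ^ 2).tendsto'
        _ _ (by simp))
    exact h.eventually_lt_const hc
  unfold kernelGrowth
  split_ifs with h2
  · subst h2
    refine ⟨2, two_pos, ?_⟩
    filter_upwards [hsmall a ha, hsmall (κ * a ^ 2) (by positivity), self_mem_nhdsWithin]
      with ρ h1 h2 h0
    rw [Set.mem_Ioi] at h0
    refine le_trans ?_ (mul_le_mul_of_nonneg_left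
      (log_le_kerProfile ha (s := 2 * ρ ^ 2) (by positivity) (by nlinarith)) two_pos.le)
    have h3 : Real.log ((a / (2 * ρ ^ 2)) ^ 2) = 2 * Real.log (a / (2 * ρ ^ 2)) := by
      rw [Real.log_pow]; norm_num
    rw [← h3]
    refine Real.log_le_log (by positivity) ?_
    rw [div_pow, div_le_div_iff₀ (by positivity) (by positivity)]
    nlinarith [mul_le_mul_of_nonneg_right h2.le (sq_nonneg ρ)]
  · set b : ℝ := ((n : ℝ) - 2) / n
    have hn0 : (n : ℝ) ≠ 0 := by positivity
    set A : ℝ := 2 * (4 : ℝ) ^ (-((n : ℝ) / 2)) with hA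
    have hA0 : 0 < A := by positivity
    refine ⟨κ ^ (-b) / A, by positivity, ?_⟩
    filter_upwards [hsmall a ha, self_mem_nhdsWithin] with ρ h1 h0
    rw [Set.mem_Ioi] at h0
    refine le_trans (le_of_eq ?_) (mul_le_mul_of_nonneg_left
      (rpow_le_kerProfile ha (s := 2 * ρ ^ 2) (by positivity) (by nlinarith))
      (by positivity : 0 ≤ κ ^ (-b) / A))
    have e1 : (ρ ^ n) ^ (-b) = ρ ^ (2 - (n : ℝ)) := by
      rw [← Real.rpow_natCast, ← Real.rpow_mul h0.le]
      congr 1; simp only [b]; field_simp; ring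
    have e2 : 2 * ρ ^ 2 * (2 * (2 * ρ ^ 2)) ^ (-((n : ℝ) / 2)) = A * ρ ^ (2 - (n : ℝ)) := by
      rw [show 2 * (2 * ρ ^ 2) = 4 * ρ ^ 2 by ring, Real.mul_rpow (by norm_num) (by positivity),
        ← Real.rpow_natCast ρ 2, ← Real.rpow_mul h0.le, hA, sub_eq_add_neg, Real.rpow_add h0,
        show ((2 : ℕ) : ℝ) * -((n : ℝ) / 2) = -(n : ℝ) by push_cast; ring, Nat.cast_ofNat]
      ring
    rw [Real.mul_rpow hκ.le (by positivity), e1, e2]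
    field_simp

theorem MemLambda0.eventually_posRearr_le (hn : 2 ≤ n) (hΩo : IsOpen Ω) (hV : volume Ω ≠ ∞)
    (hne : Ω.Nonempty) {u : Euc n → ℝ} (hu : AEMeasurable u (volume.restrict Ω))
    (hL : MemLambda0 n Ω u) (ha : 0 < a) {κ : ℝ} (hκ : 0 < κ) {ε : ℝ} (hε : 0 < ε) :
    ∀ᶠ ρ in 𝓝[>] (0 : ℝ),
      posRearr n Ω u (κ * ρ ^ n) ≤ ε * kerProfile n a (2 * ρ ^ 2) := by
  obtain ⟨C, hC, hCe⟩ := eventually_kernelGrowth_le hn ha hκ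
  have ht : Tendsto (fun ρ : ℝ => κ * ρ ^ n) (𝓝[>] 0) (𝓝[>] 0) := by
    refine tendsto_nhdsWithin_iff.2 ⟨?_, ?_⟩
    · exact tendsto_nhdsWithin_of_tendsto_nhds
        ((by fun_prop : Continuous fun ρ : ℝ => κ * ρ ^ n).tendsto' _ _
          (by simp [show n ≠ 0 by omega]))
    · filter_upwards [self_mem_nhdsWithin] with ρ h0
      rw [Set.mem_Ioi] at h0 ⊢
      positivity
  have hd := ht.eventually (hL.eventually_decRearr_le hn hΩo hV hne hu (div_pos hε hC))
  filter_upwards [hCe, hd, self_mem_nhdsWithin] with ρ h1 h2 h0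
  rw [Set.mem_Ioi] at h0
  rw [posRearr, if_pos (by positivity)]
  refine h2.trans ((mul_le_mul_of_nonneg_left h1 (div_pos hε hC).le).trans (le_of_eq ?_))
  field_simp

/-- A superposition of regularised kernels dominates, near `x₀`, any radial function that is
eventually small compared with the kernel. -/
theorem exists_memW21Delta0_dominating (hn : 2 ≤ n) (hV : volume Ω ≠ ∞) (ha : 0 < a) {x₀ : Euc n}
    {δ : ℝ} (hδ : 0 < δ) (hδa : 2 * a = δ ^ 2) (hΩ : Metric.closedBall x₀ δ ⊆ Ω) {p : ℝ → ℝ}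
    (hp : ∀ ε, 0 < ε → ∀ᶠ ρ in 𝓝[>] (0 : ℝ), p ρ ≤ ε * kerProfile n a (2 * ρ ^ 2)) :
    ∃ w f, MemW21Delta0 n Ω w f ∧ (∀ x, 0 ≤ w x) ∧ ∃ d, 0 < d ∧ d ≤ δ ∧
      ∀ᵐ x ∂(volume.restrict Ω), dist x x₀ < d → p (dist x x₀) ≤ w x := by
  have hd : ∀ k : ℕ, ∃ d : ℝ, 0 < d ∧ d ≤ δ ∧ d ≤ 1 / ((k : ℝ) + 1) ∧
      ∀ ρ, 0 < ρ → ρ < d → p ρ ≤ (1 / 2) ^ k * kerProfile n a (2 * ρ ^ 2) := fun k => by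
    obtain ⟨d, hd0, hd⟩ := mem_nhdsGT_iff_exists_Ioo_subset.1 (hp ((1 / 2) ^ k) (by positivity))
    rw [Set.mem_Ioi] at hd0
    exact ⟨min d (min δ (1 / ((k : ℝ) + 1))), by positivity,
      (min_le_right _ _).trans (min_le_left _ _), (min_le_right _ _).trans (min_le_right _ _),
      fun ρ h0 h1 => hd ⟨h0, h1.trans_le (min_le_left _ _)⟩⟩
  choose d hd0 hdδ hdk hdp using hd
  set w : ℕ → Euc n → ℝ := fun k x => (1 / 2) ^ k * regKer n a x₀ (d (k + 1)) x with hw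
  have htest : ∀ k, IsTestFun n Ω (regKer n a x₀ (d (k + 1))) := fun k =>
    regKer_isTestFun ha hδ.le hδa hΩ (hd0 _)
  have hwt : ∀ k, IsTestFun n Ω (w k) := fun k => (htest k).const_mul _
  have hw0 : ∀ k x, 0 ≤ w k x := fun k x =>
    mul_nonneg (by positivity) (kerProfile_nonneg ha (by have := hd0 (k + 1); positivity))
  obtain ⟨C0, hC0⟩ := exists_bound_integral_regKer hn ha x₀ hδ.le hδa hΩ
  obtain ⟨C1, hC1⟩ := exists_bound_integral_lapl_regKer hV ha x₀ hδ.le hδa hΩ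
  have hs0 : Summable fun k => ∫ x in Ω, |w k x| := by
    refine Summable.of_nonneg_of_le (fun k => integral_nonneg fun x => abs_nonneg _)
      (fun k => ?_) (summable_geometric_two.mul_right C0)
    simp only [hw, abs_mul]
    rw [integral_const_mul, abs_of_nonneg (by positivity)]
    exact mul_le_mul_of_nonneg_left (hC0 _ (hd0 _)) (by positivity)
  have hs1 : Summable fun k => ∫ x in Ω, |lapl n (w k) x| := by
    refine Summable.of_nonneg_of_le (fun k => integral_nonneg fun x => abs_nonneg _)
      (fun k => ?_) (summable_geometric_two.mul_right C1)
    simp only [hw, lapl_const_mul _ (htest k), abs_mul]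
    rw [integral_const_mul, abs_of_nonneg (by positivity)]
    exact mul_le_mul_of_nonneg_left (hC1 _ (hd0 _)) (by positivity)
  refine ⟨_, _, memW21Delta0_tsum hwt hs0 hs1, fun x => tsum_nonneg fun k => hw0 k x, d 0, hd0 0,
    hdδ 0, ?_⟩
  filter_upwards [ae_restrict_of_ae (ae_ne_point hn x₀),
    (ae_summable_norm_of_summable_integral_norm
      (fun k => (hwt k).integrable.integrableOn) hs0).1] with x hx hsum hlt
  have hρ : 0 < dist x x₀ := dist_pos.2 hx
  have hex : ∃ m : ℕ, d m ≤ dist x x₀ := by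
    obtain ⟨m, hm⟩ := exists_nat_one_div_lt hρ
    exact ⟨m, (hdk m).trans hm.le⟩
  classical
  obtain ⟨k, hk⟩ : ∃ k, Nat.find hex = k + 1 := by
    refine Nat.exists_eq_succ_of_ne_zero fun h => ?_
    have := Nat.find_spec hex
    rw [h] at this
    exact hlt.not_ge this
  have hk1 : d (k + 1) ≤ dist x x₀ := hk ▸ Nat.find_spec hex
  have hk2 : dist x x₀ < d k := not_le.1 (Nat.find_min hex (by omega))
  refine (hdp k _ hρ hk2).trans (le_trans ?_ ((hsum.of_abs).le_tsum k fun j _ => hw0 j x))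
  refine mul_le_mul_of_nonneg_left ?_ (by positivity)
  rw [regKer, ← dist_eq_norm]
  refine kerProfile_antitone ha (by positivity) ?_
  nlinarith [hd0 (k + 1)]

theorem ballVol_eq (hn : 2 ≤ n) {x₀ : Euc n} {δ : ℝ} (hΩ : Metric.closedBall x₀ δ ⊆ Ω) {r : ℝ}
    (hr : 0 ≤ r) (hrδ : r ≤ δ) :
    ballVol Ω x₀ r = volume.real (Metric.ball (0 : Euc n) 1) * r ^ n := by
  rw [ballVol, Set.inter_eq_self_of_subset_right
    ((Metric.ball_subset_closedBall.trans (Metric.closedBall_subset_closedBall hrδ)).trans hΩ),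
    volume_real_ball hn x₀ hr, mul_comm]

end

/-- For Ω ⊆ ℝⁿ (n ≥ 2) open and bounded and any r.i. space X over Ω,
if W^{2,1}_{Δ,0}(Ω) ⊆ X then Λ_n^0(Ω) ⊆ X; i.e. Λ_n^0(Ω) is the smallest r.i. space
over Ω containing W^{2,1}_{Δ,0}(Ω). -/
theorem stmt_18 (n : ℕ) (hn : 2 ≤ n) (Ω : Set (Euc n)) (hΩo : IsOpen Ω)
    (hΩb : Bornology.IsBounded Ω) (X : RISpace n Ω)
    (hW : ∀ u f : Euc n → ℝ, MemW21Delta0 n Ω u f → u ∈ X.carrier) :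
    ∀ u : Euc n → ℝ, AEMeasurable u (volume.restrict Ω) → MemLambda0 n Ω u →
      u ∈ X.carrier := by
  intro u hu hL
  have hV : volume Ω ≠ ∞ := hΩb.measure_lt_top.ne
  rcases Ω.eq_empty_or_nonempty with rfl | ⟨x₀, hx₀⟩
  · exact (X.ideal 0 u X.zero_mem hu (by simp)).1
  obtain ⟨δ, hδ, hδΩ⟩ := Metric.nhds_basis_closedBall.mem_iff.1 (hΩo.mem_nhds hx₀)
  have ha : 0 < δ ^ 2 / 2 := by positivity
  have hκ : 0 < volume.real (Metric.ball (0 : Euc n) 1) :=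
    ENNReal.toReal_pos (Metric.measure_ball_pos volume _ one_pos).ne' measure_ball_lt_top.ne
  obtain ⟨w, f, hw, hw0, d, hd, hdδ, hdw⟩ := exists_memW21Delta0_dominating hn hV ha hδ
    (by ring) hδΩ fun ε hε =>
      hL.eventually_posRearr_le hn hΩo hV ⟨x₀, hx₀⟩ hu ha hκ hε
  set M := decRearr n Ω u (ballVol Ω x₀ d)
  have hM : 0 ≤ M := decRearr_nonneg _ _
  have hX : w + M • (1 : Euc n → ℝ) ∈ X.carrier :=
    X.add_mem _ _ (hW w f hw) (X.smul_mem M _ (X.one_mem hn hΩo hΩb hW hx₀))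
  have hle : ∀ᵐ x ∂(volume.restrict Ω),
      |sphRearr n Ω u x₀ x| ≤ |(w + M • (1 : Euc n → ℝ)) x| := by
    filter_upwards [hdw] with x hx
    have e : (w + M • (1 : Euc n → ℝ)) x = w x + M := by simp
    rw [e, sphRearr, abs_of_nonneg (posRearr_nonneg _ _), abs_of_nonneg (add_nonneg (hw0 x) hM)]
    rcases lt_or_ge (dist x x₀) d with h | h
    · rw [ballVol_eq hn hδΩ dist_nonneg (h.le.trans hdδ)]
      exact (hx h).trans (le_add_of_nonneg_right hM)
    · have hb := ballVol_pos hΩo hV hx₀ hd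
      have hbm := ballVol_mono hV x₀ h
      rw [posRearr, if_pos (hb.trans_le hbm)]
      exact (decRearr_antitone hΩo hV hu hb hbm).trans (le_add_of_nonneg_left (hw0 x))
  have hsph := (X.ideal _ _ hX (measurable_sphRearr hΩo hV hu x₀).aemeasurable hle).1
  exact (X.rearr_invariant _ u hsph hu fun s hs =>
    volume_superlevel_sphRearr hn hΩo hΩb hu hx₀ hs).1
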